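/- arXiv:1609.02695 — 2 statements merged into one kernel-verified Lean document; each statement's English description precedes it below -/
import Mathlib

section
/- Let n ≥ 2 and let β¹, …, β^m (m ≥ 1) be nonzero weights for Gr(1,n) such that ∑_i rank(β^i) = n − 5 and ∑_i dex(β^i) = n. Then n ≥ 6, m = n − 5, and every β^i has the form (d_i, 0, …, 0) with d_i ≥ 1 and d₁ + … + d_m = n. (This is the combinatorial content of case (a) of the classification of fourfolds with trivial canonical bundle in Grassmannians: in projective space only complete intersections of hypersurfaces of total degree n occur.) -/
open Finset

/-- Weyl dimension formula `D_r` for `sl(r)`, applied to the entries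
`β 0, …, β (r-1)` (0-indexed versions of `β₁, …, β_r`). -/
def slDim (r : ℕ) (β : ℕ → ℚ) : ℚ :=
  ∏ i ∈ Finset.range r, ∏ j ∈ Finset.range r,
    if i < j then ((j : ℚ) - (i : ℚ) + β i - β j) / ((j : ℚ) - (i : ℚ)) else 1

/-- Weyl dimension formula `C_m` for `sp(2m)`. -/
def spDim (m : ℕ) (β : ℕ → ℚ) : ℚ :=
  slDim m β *
    ∏ i ∈ Finset.range m, ∏ j ∈ Finset.range m,
      if i ≤ j then
        ((2 * m : ℚ) - (i : ℚ) - (j : ℚ) + β i + β j) /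
          ((2 * m : ℚ) - (i : ℚ) - (j : ℚ))
      else 1

/-- Weyl dimension formula `B_m` for `so(2m+1)`. -/
def soOddDim (m : ℕ) (β : ℕ → ℚ) : ℚ :=
  slDim m β *
    ∏ i ∈ Finset.range m, ∏ j ∈ Finset.range m,
      if i ≤ j then
        ((2 * m : ℚ) - 1 - (i : ℚ) - (j : ℚ) + β i + β j) /
          ((2 * m : ℚ) - 1 - (i : ℚ) - (j : ℚ))
      else 1

/-- Weyl dimension formula `E_m` for `so(2m)`. -/
def soEvenDim (m : ℕ) (β : ℕ → ℚ) : ℚ :=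
  slDim m β *
    ∏ i ∈ Finset.range m, ∏ j ∈ Finset.range m,
      if i < j then
        ((2 * m : ℚ) - 2 - (i : ℚ) - (j : ℚ) + β i + β j) /
          ((2 * m : ℚ) - 2 - (i : ℚ) - (j : ℚ))
      else 1

/-- The tuple determined by a list, extended by zeros. -/
def lw (l : List ℚ) : ℕ → ℚ := fun i => l.getD i 0

/-- `β₁ + ⋯ + β_k` (the sum of the first `k` entries). -/
def headSum (k : ℕ) (β : ℕ → ℚ) : ℚ := ∑ i ∈ Finset.range k, β i

/-- A weight for the ordinary Grassmannian `Gr(k,n)`: integers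
`β₁ ≥ β₂ ≥ ⋯ ≥ β_n = 0`, extended by zeros beyond position `n`. -/
def IsGrWeight (n : ℕ) (β : ℕ → ℚ) : Prop :=
  (∀ i, ∃ z : ℤ, β i = (z : ℚ)) ∧ (∀ i j, i ≤ j → β j ≤ β i) ∧ ∀ i, n - 1 ≤ i → β i = 0

/-- `rank(β) = D_k(β₁,…,β_k) ⬝ D_{n-k}(β_{k+1},…,β_n)` on `Gr(k,n)`. -/
def grRank (k n : ℕ) (β : ℕ → ℚ) : ℚ := slDim k β * slDim (n - k) (fun i => β (k + i))

/-- `dex(β) = (|β|₁/k − |β|₂/(n−k)) ⬝ rank(β)` on `Gr(k,n)`. -/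
def grDex (k n : ℕ) (β : ℕ → ℚ) : ℚ :=
  (headSum k β / (k : ℚ) -
      (∑ i ∈ Finset.range (n - k), β (k + i)) / ((n : ℚ) - (k : ℚ))) * grRank k n β

/-- A weight for the symplectic Grassmannian `IGr(k,2n)`: integers
`β₁ ≥ ⋯ ≥ β_n ≥ 0`, extended by zeros beyond position `n`. -/
def IsIGrWeight (n : ℕ) (β : ℕ → ℚ) : Prop :=
  (∀ i, ∃ z : ℤ, β i = (z : ℚ)) ∧ (∀ i j, i ≤ j → β j ≤ β i) ∧ ∀ i, n ≤ i → β i = 0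

/-- `rank(β) = D_k(β₁,…,β_k) ⬝ C_{n-k}(β_{k+1},…,β_n)` on `IGr(k,2n)`. -/
def igrRank (k n : ℕ) (β : ℕ → ℚ) : ℚ := slDim k β * spDim (n - k) (fun i => β (k + i))

/-- `dex(β) = ((β₁+⋯+β_k)/k) ⬝ rank(β)` on `IGr(k,2n)`. -/
def igrDex (k n : ℕ) (β : ℕ → ℚ) : ℚ := headSum k β / (k : ℚ) * igrRank k n β

/-- A weight for the odd orthogonal Grassmannian `OGr(k,2n+1)`:
`β₁ ≥ ⋯ ≥ β_n ≥ 0`, all entries integers or all half-odd-integers,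
extended by zeros beyond position `n`. -/
def IsOGrOddWeight (n : ℕ) (β : ℕ → ℚ) : Prop :=
  ((∀ i, i < n → ∃ z : ℤ, β i = (z : ℚ)) ∨
    (∀ i, i < n → ∃ z : ℤ, β i = (z : ℚ) + 1/2)) ∧
  (∀ i j, i ≤ j → j < n → β j ≤ β i) ∧ (∀ i, i < n → 0 ≤ β i) ∧ ∀ i, n ≤ i → β i = 0

/-- `rank(β) = D_k(β₁,…,β_k) ⬝ B_{n-k}(β_{k+1},…,β_n)` on `OGr(k,2n+1)`. -/
def ogrOddRank (k n : ℕ) (β : ℕ → ℚ) : ℚ :=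
  slDim k β * soOddDim (n - k) (fun i => β (k + i))

/-- `dex(β) = ((β₁+⋯+β_k)/k) ⬝ rank(β)` on `OGr(k,2n+1)`. -/
def ogrOddDex (k n : ℕ) (β : ℕ → ℚ) : ℚ := headSum k β / (k : ℚ) * ogrOddRank k n β

/-- A weight for the even orthogonal Grassmannian `OGr(k,2n)`:
`β₁ ≥ ⋯ ≥ β_{n-1} ≥ |β_n|`, all entries integers or all half-odd-integers,
extended by zeros beyond position `n`. -/
def IsOGrEvenWeight (n : ℕ) (β : ℕ → ℚ) : Prop :=
  ((∀ i, i < n → ∃ z : ℤ, β i = (z : ℚ)) ∨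
    (∀ i, i < n → ∃ z : ℤ, β i = (z : ℚ) + 1/2)) ∧
  (∀ i j, i ≤ j → j + 1 < n → β j ≤ β i) ∧
  (∀ i, i + 1 < n → |β (n - 1)| ≤ β i) ∧ ∀ i, n ≤ i → β i = 0

/-- `rank(β) = D_k(β₁,…,β_k) ⬝ E_{n-k}(β_{k+1},…,β_n)` on `OGr(k,2n)`. -/
def ogrEvenRank (k n : ℕ) (β : ℕ → ℚ) : ℚ :=
  slDim k β * soEvenDim (n - k) (fun i => β (k + i))

/-- `dex(β) = ((β₁+⋯+β_k)/k) ⬝ rank(β)` on `OGr(k,2n)`. -/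
def ogrEvenDex (k n : ℕ) (β : ℕ → ℚ) : ℚ := headSum k β / (k : ℚ) * ogrEvenRank k n β

/-- Replace the last entry `β_n` by its negative. -/
def negLast (n : ℕ) (β : ℕ → ℚ) : ℕ → ℚ := fun i => if i = n - 1 then -β i else β i

theorem slDim_succ (r : ℕ) (γ : ℕ → ℚ) :
    slDim (r + 1) γ =
      slDim r γ * ∏ i ∈ range r, ((r : ℚ) - (i : ℚ) + γ i - γ r) / ((r : ℚ) - (i : ℚ)) := by
  have last_row : (∏ j ∈ range (r + 1),
      if r < j then ((j : ℚ) - (r : ℚ) + γ r - γ j) / ((j : ℚ) - (r : ℚ)) else 1) = 1 :=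
    prod_eq_one fun j hj => if_neg (by have := mem_range.1 hj; omega)
  unfold slDim
  rw [prod_range_succ, last_row, mul_one, ← prod_mul_distrib]
  refine prod_congr rfl fun i hi => ?_
  rw [prod_range_succ, if_pos (mem_range.1 hi)]

theorem one_le_slDim_factor {γ : ℕ → ℚ} (hγ : Antitone γ) {i j : ℕ} (hij : i < j) :
    1 ≤ ((j : ℚ) - (i : ℚ) + γ i - γ j) / ((j : ℚ) - (i : ℚ)) := by
  have hpos : (0 : ℚ) < (j : ℚ) - (i : ℚ) := sub_pos.2 (by exact_mod_cast hij)
  have := hγ hij.le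
  rw [le_div_iff₀ hpos]
  linarith

theorem one_le_slDim {γ : ℕ → ℚ} (hγ : Antitone γ) (r : ℕ) : 1 ≤ slDim r γ := by
  induction r with
  | zero => simp [slDim]
  | succ r ih =>
    rw [slDim_succ]
    exact one_le_mul_of_one_le_of_one_le ih
      (Finset.one_le_prod fun i hi => one_le_slDim_factor hγ (mem_range.1 hi))

theorem slDim_of_forall_eq_zero {γ : ℕ → ℚ} (hγ : ∀ i, γ i = 0) (r : ℕ) : slDim r γ = 1 := by
  induction r with
  | zero => simp [slDim]
  | succ r ih =>
    rw [slDim_succ, ih, one_mul]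
    refine prod_eq_one fun i hi => ?_
    have hpos : (0 : ℚ) < (r : ℚ) - (i : ℚ) := sub_pos.2 (by exact_mod_cast mem_range.1 hi)
    rw [hγ, hγ, add_zero, sub_zero, div_self hpos.ne']

theorem add_one_le_of_lt_of_integral {γ : ℕ → ℚ} (hint : ∀ i, ∃ z : ℤ, γ i = (z : ℚ)) {i j : ℕ}
    (h : γ i < γ j) : γ i + 1 ≤ γ j := by
  obtain ⟨a, ha⟩ := hint i
  obtain ⟨b, hb⟩ := hint j
  rw [ha, hb] at h ⊢
  exact_mod_cast Int.add_one_le_iff.2 (Int.cast_lt.1 h)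

theorem prod_range_sub_add_one_div (r : ℕ) :
    ∏ i ∈ range r, ((r : ℚ) - (i : ℚ) + 1) / ((r : ℚ) - (i : ℚ)) = (r : ℚ) + 1 := by
  induction r with
  | zero => simp
  | succ r ih =>
    rw [prod_range_succ']
    have shift : ∀ i ∈ range r,
        (((r + 1 : ℕ) : ℚ) - ((i + 1 : ℕ) : ℚ) + 1) / (((r + 1 : ℕ) : ℚ) - ((i + 1 : ℕ) : ℚ)) =
          ((r : ℚ) - (i : ℚ) + 1) / ((r : ℚ) - (i : ℚ)) := by
      intro i _
      push_cast
      congr 1 <;> ring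
    rw [prod_congr rfl shift, ih]
    push_cast
    have : (r : ℚ) + 1 ≠ 0 := by positivity
    field_simp
    ring

/-- A nontrivial irreducible representation of `sl(r + 1)` has dimension at least `r + 1`. -/
theorem succ_le_slDim {γ : ℕ → ℚ} (hγ : Antitone γ) (hint : ∀ i, ∃ z : ℤ, γ i = (z : ℚ))
    (r : ℕ) (h : γ r < γ 0) : (r : ℚ) + 1 ≤ slDim (r + 1) γ := by
  induction r with
  | zero => exact absurd h (lt_irrefl _)
  | succ r ih =>
    have hstep := add_one_le_of_lt_of_integral hint h
    rw [slDim_succ]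
    rcases (hγ (Nat.zero_le r)).lt_or_eq with hlt | heq
    · have hr : (0 : ℚ) < (r : ℚ) + 1 := by positivity
      rw [prod_range_succ']
      have hfirst : ((r : ℚ) + 1 + 1) / ((r : ℚ) + 1) ≤
          (((r + 1 : ℕ) : ℚ) - ((0 : ℕ) : ℚ) + γ 0 - γ (r + 1)) /
            (((r + 1 : ℕ) : ℚ) - ((0 : ℕ) : ℚ)) := by
        push_cast
        rw [sub_zero]
        gcongr
        linarith
      have hrest := Finset.one_le_prod fun i (hi : i ∈ range r) =>
        one_le_slDim_factor hγ (i := i + 1) (j := r + 1) (by have := mem_range.1 hi; omega)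
      calc ((r + 1 : ℕ) : ℚ) + 1
          = ((r : ℚ) + 1) * (1 * (((r : ℚ) + 1 + 1) / ((r : ℚ) + 1))) := by
            push_cast
            field_simp
        _ ≤ _ := by
            have hdim := ih hlt
            have := hr.le.trans hdim
            gcongr
    · have hcol : ((r + 1 : ℕ) : ℚ) + 1 ≤ ∏ i ∈ range (r + 1),
          (((r + 1 : ℕ) : ℚ) - (i : ℚ) + γ i - γ (r + 1)) / (((r + 1 : ℕ) : ℚ) - (i : ℚ)) := by
        rw [← prod_range_sub_add_one_div]
        refine prod_le_prod (fun i hi => ?_) fun i hi => ?_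
        all_goals
          have hpos : (0 : ℚ) < ((r + 1 : ℕ) : ℚ) - (i : ℚ) :=
            sub_pos.2 (by exact_mod_cast mem_range.1 hi)
        · positivity
        · have := hγ (Nat.lt_succ_iff.1 (mem_range.1 hi))
          gcongr
          linarith
      have hone := one_le_slDim hγ (r + 1)
      calc ((r + 1 : ℕ) : ℚ) + 1 = 1 * (((r + 1 : ℕ) : ℚ) + 1) := (one_mul _).symm
        _ ≤ _ := by gcongr

theorem grRank_one (n : ℕ) (β : ℕ → ℚ) :
    grRank 1 n β = slDim (n - 1) fun i => β (1 + i) := by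
  simp [grRank, slDim]

theorem IsGrWeight.antitone_tail {n : ℕ} {β : ℕ → ℚ} (h : IsGrWeight n β) :
    Antitone fun i => β (1 + i) :=
  fun _ _ hij => h.2.1 _ _ (by omega)

theorem IsGrWeight.nonneg {n : ℕ} {β : ℕ → ℚ} (h : IsGrWeight n β) (i : ℕ) : 0 ≤ β i := by
  rw [← h.2.2 (max i (n - 1)) (le_max_right _ _)]
  exact h.2.1 _ _ (le_max_left _ _)

theorem IsGrWeight.one_le_grRank_one {n : ℕ} {β : ℕ → ℚ} (h : IsGrWeight n β) :
    1 ≤ grRank 1 n β := by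
  rw [grRank_one]
  exact one_le_slDim h.antitone_tail _

theorem IsGrWeight.sub_one_le_grRank_one {n : ℕ} (hn : 2 ≤ n) {β : ℕ → ℚ} (h : IsGrWeight n β)
    (h1 : β 1 ≠ 0) : (n : ℚ) - 1 ≤ grRank 1 n β := by
  obtain ⟨r, rfl⟩ : ∃ r, n = r + 2 := ⟨n - 2, by omega⟩
  rw [grRank_one]
  have hlast : β (1 + r) = 0 := h.2.2 _ (by omega)
  have := succ_le_slDim h.antitone_tail (fun i => h.1 (1 + i)) r
    (by simpa [hlast] using lt_of_le_of_ne (h.nonneg 1) h1.symm)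
  push_cast
  linarith

theorem IsGrWeight.eq_zero_of_one_le {n : ℕ} {β : ℕ → ℚ} (h : IsGrWeight n β) (h1 : β 1 = 0)
    {j : ℕ} (hj : 1 ≤ j) : β j = 0 :=
  le_antisymm (h1 ▸ h.2.1 1 j hj) (h.nonneg j)

theorem IsGrWeight.one_le_apply_zero {n : ℕ} {β : ℕ → ℚ} (h : IsGrWeight n β) (h1 : β 1 = 0)
    (hne : β ≠ 0) : 1 ≤ β 0 := by
  have h0 : β 0 ≠ 0 := fun h0 => hne <| funext fun j => by
    rcases Nat.eq_zero_or_pos j with rfl | hj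
    · exact h0
    · exact h.eq_zero_of_one_le h1 hj
  have hlt : β 1 < β 0 := h1 ▸ lt_of_le_of_ne (h.nonneg 0) h0.symm
  simpa [h1] using add_one_le_of_lt_of_integral h.1 hlt

theorem grRank_one_of_tail_eq_zero (n : ℕ) {β : ℕ → ℚ} (h : ∀ j, 1 ≤ j → β j = 0) :
    grRank 1 n β = 1 := by
  rw [grRank_one]
  exact slDim_of_forall_eq_zero (fun i => h _ (by omega)) _

theorem grDex_one_of_tail_eq_zero (n : ℕ) {β : ℕ → ℚ} (h : ∀ j, 1 ≤ j → β j = 0) :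
    grDex 1 n β = β 0 := by
  have htail : ∑ i ∈ range (n - 1), β (1 + i) = 0 := sum_eq_zero fun i _ => h _ (by omega)
  simp [grDex, headSum, htail, grRank_one_of_tail_eq_zero n h]

/-- Case (a) of the classification: nonzero weights on `Gr(1,n)` whose ranks sum
to `n − 5` and whose dex's sum to `n` force `n ≥ 6`, exactly `n − 5` weights,
each a line bundle `(d_i, 0, …, 0)` with `d_i ≥ 1` and `∑ d_i = n`. -/
theorem stmt6 (n : ℕ) (hn : 2 ≤ n) (S : Multiset (ℕ → ℚ)) (hS : 1 ≤ Multiset.card S)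
    (hw : ∀ β ∈ S, IsGrWeight n β ∧ β ≠ 0)
    (hr : (S.map (grRank 1 n)).sum = (n : ℚ) - 5)
    (hd : (S.map (grDex 1 n)).sum = (n : ℚ)) :
    6 ≤ n ∧ Multiset.card S = n - 5 ∧
      (∀ β ∈ S, 1 ≤ β 0 ∧ ∀ j, 1 ≤ j → β j = 0) ∧
      (S.map (fun β => β 0)).sum = (n : ℚ) := by
  have hone : ∀ β ∈ S, β 1 = 0 := by
    intro β hβ
    by_contra h1
    have hle : grRank 1 n β ≤ (S.map (grRank 1 n)).sum := by
      refine Multiset.single_le_sum (fun x hx => ?_) _ (Multiset.mem_map_of_mem _ hβ)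
      obtain ⟨β', hβ', rfl⟩ := Multiset.mem_map.1 hx
      exact zero_le_one.trans (hw β' hβ').1.one_le_grRank_one
    have := (hw β hβ).1.sub_one_le_grRank_one hn h1
    linarith
  have htail : ∀ β ∈ S, ∀ j, 1 ≤ j → β j = 0 :=
    fun β hβ _ hj => (hw β hβ).1.eq_zero_of_one_le (hone β hβ) hj
  rw [Multiset.map_congr rfl fun β hβ => grRank_one_of_tail_eq_zero n (htail β hβ)] at hr
  rw [Multiset.map_congr rfl fun β hβ => grDex_one_of_tail_eq_zero n (htail β hβ)] at hd
  have hcard : Multiset.card S + 5 = n := by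
    have : (Multiset.card S : ℚ) = (n : ℚ) - 5 := by simpa using hr
    have : ((Multiset.card S + 5 : ℕ) : ℚ) = (n : ℚ) := by
      push_cast
      linarith
    exact_mod_cast this
  exact ⟨by omega, by omega,
    fun β hβ => ⟨(hw β hβ).1.one_le_apply_zero (hone β hβ) (hw β hβ).2, htail β hβ⟩, hd⟩
end

section
/- Let n ≥ 9 and let β be a nonzero weight for Gr(3,n) with rank(β) ≤ 3(n−3) − 4. Then either β₄ = β₅ = … = β_n = 0, or β = (r, r, r, 1, 0, …, 0) for some integer r ≥ 1, or β = (s, s, s, 1, 1, …, 1, 0) for some integer s ≥ 1 (the tail (β₄,…,β_n) being (1,…,1,0)). -/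
open Finset

/-- A product of lower bounds for the factors bounds the Weyl dimension from below. -/
lemma prod_le_slDim (r : ℕ) (β : ℕ → ℚ) (G : ℕ → ℕ → ℚ)
    (h0 : ∀ i j, i < j → j < r → 0 ≤ G i j)
    (h : ∀ i j, i < j → j < r → G i j * ((j : ℚ) - i) ≤ (j : ℚ) - i + β i - β j) :
    ∏ i ∈ range r, ∏ j ∈ range r, (if i < j then G i j else 1) ≤ slDim r β := by
  unfold slDim
  have nonneg : ∀ i j, j < r → 0 ≤ if i < j then G i j else 1 := by
    intro i j hj
    split_ifs with hij
    · exact h0 i j hij hj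
    · exact zero_le_one
  refine prod_le_prod (fun i _ => prod_nonneg fun j hj => nonneg i j (mem_range.1 hj)) ?_
  intro i _
  refine prod_le_prod (fun j hj => nonneg i j (mem_range.1 hj)) ?_
  intro j hj
  split_ifs with hij
  · have : (i : ℚ) < j := by exact_mod_cast hij
    rw [le_div_iff₀ (by linarith)]
    exact h i j hij (mem_range.1 hj)
  · exact le_rfl

lemma one_le_slDim_s8 (r : ℕ) (β : ℕ → ℚ) (hβ : ∀ i j, i ≤ j → β j ≤ β i) : 1 ≤ slDim r β := by
  have := prod_le_slDim r β (fun _ _ => 1) (fun _ _ _ _ => zero_le_one)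
    (fun i j hij _ => by linarith [hβ i j hij.le])
  simpa using this

lemma prod_ratio_eq (i p d : ℕ) (hip : i < p) :
    ∏ j ∈ range (p + d), (if p ≤ j then ((j : ℚ) - i + 1) / (j - i) else 1) =
      (((p + d : ℕ) : ℚ) - i) / (p - i) := by
  have hp : (i : ℚ) < p := by exact_mod_cast hip
  induction d with
  | zero =>
    rw [add_zero, div_self (by linarith)]
    exact prod_eq_one fun j hj => if_neg (by simpa using hj)
  | succ d ih =>
    have hd : (0 : ℚ) ≤ d := Nat.cast_nonneg d
    rw [← add_assoc, prod_range_succ, ih, if_pos (by omega)]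
    have h1 : (p : ℚ) - i ≠ 0 := by linarith
    have h2 : (p : ℚ) + d - i ≠ 0 := by linarith
    push_cast
    field_simp
    ring

lemma prod_sub_div_sub_eq_choose (m p : ℕ) (hp : p ≤ m) :
    ∏ i ∈ range p, ((m : ℚ) - i) / (p - i) = m.choose p := by
  rw [prod_div_distrib]
  have key : ∀ k, p ≤ k → ∏ i ∈ range p, ((k : ℚ) - i) = k.descFactorial p := by
    intro k hk
    rw [Nat.descFactorial_eq_prod_range, Nat.cast_prod]
    refine prod_congr rfl fun i hi => ?_
    rw [Nat.cast_sub (by have := mem_range.1 hi; omega)]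
  rw [key m hp, key p le_rfl, Nat.descFactorial_self, Nat.descFactorial_eq_factorial_mul_choose,
    Nat.cast_mul]
  have : (p.factorial : ℚ) ≠ 0 := by exact_mod_cast p.factorial_ne_zero
  field_simp

/-- If `β` has a jump at position `p`, its Weyl dimension is at least that of the
`p`-th fundamental representation. -/
lemma choose_le_slDim (m p : ℕ) (β : ℕ → ℚ) (hp : 0 < p) (hpm : p ≤ m)
    (hβ : ∀ i j, i ≤ j → β j ≤ β i) (hjump : β p + 1 ≤ β (p - 1)) :
    (m.choose p : ℚ) ≤ slDim m β := by
  have hle := prod_le_slDim m β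
    (fun i j => if i < p then if p ≤ j then ((j : ℚ) - i + 1) / (j - i) else 1 else 1)
    (fun i j hij _ => by
      have : (i : ℚ) < j := by exact_mod_cast hij
      split_ifs
      · exact div_nonneg (by linarith) (by linarith)
      · exact zero_le_one
      · exact zero_le_one)
    (fun i j hij _ => by
      have : (i : ℚ) < j := by exact_mod_cast hij
      have hb := hβ i j hij.le
      split_ifs with h1 h2
      · rw [div_mul_cancel₀ _ (by linarith)]
        linarith [hβ i (p - 1) (by omega), hβ p j h2]
      · linarith
      · linarith)
  refine le_of_eq_of_le ?_ hle
  obtain ⟨d, rfl⟩ := Nat.exists_eq_add_of_le hpm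
  have hrow : ∀ i ∈ range (p + d), ∏ j ∈ range (p + d), (if i < j then
      (if i < p then if p ≤ j then ((j : ℚ) - i + 1) / (j - i) else 1 else 1) else 1) =
      if i < p then (((p + d : ℕ) : ℚ) - i) / (p - i) else 1 := by
    intro i _
    split_ifs with hi
    · rw [← prod_ratio_eq i p d hi]
      refine prod_congr rfl fun j _ => ?_
      split_ifs <;> first | rfl | omega
    · exact prod_eq_one fun j _ => by split_ifs <;> rfl
  rw [prod_congr rfl hrow, prod_range_add, ← prod_sub_div_sub_eq_choose _ _ hpm]
  rw [prod_eq_one (s := range d) fun i _ => if_neg (by omega), mul_one]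
  exact prod_congr rfl fun i hi => (if_pos (mem_range.1 hi)).symm

lemma prod_succ_add_two_div (M : ℕ) :
    ∏ j ∈ range M, ((j : ℚ) + 3) / (j + 1) = (M + 1) * (M + 2) / 2 := by
  induction M with
  | zero => norm_num
  | succ M ih =>
    rw [prod_range_succ, ih]
    have : (M : ℚ) + 1 ≠ 0 := by positivity
    push_cast
    field_simp
    ring

lemma prod_succ_add_one_div (M : ℕ) :
    ∏ j ∈ range M, ((j : ℚ) + 2) / (j + 1) = M + 1 := by
  induction M with
  | zero => norm_num
  | succ M ih =>
    rw [prod_range_succ, ih]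
    have : (M : ℚ) + 1 ≠ 0 := by positivity
    push_cast
    field_simp
    ring

/-- The first row of factors bounds the Weyl dimension when the first jump is at least two. -/
lemma le_slDim_of_two_le_first_jump (M : ℕ) (β : ℕ → ℚ)
    (hβ : ∀ i j, i ≤ j → β j ≤ β i) (hjump : β 1 + 2 ≤ β 0) :
    ((M : ℚ) + 1) * (M + 2) / 2 ≤ slDim (M + 1) β := by
  have hle := prod_le_slDim (M + 1) β (fun i j => if i = 0 then ((j : ℚ) + 2) / j else 1)
    (fun i j _ _ => by
      split_ifs <;> positivity)
    (fun i j hij _ => by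
      have hb := hβ i j hij.le
      split_ifs with h
      · subst h
        have : (0 : ℚ) < j := by exact_mod_cast hij
        rw [Nat.cast_zero, sub_zero, div_mul_cancel₀ _ this.ne']
        linarith [hβ 1 j hij]
      · linarith)
  refine le_of_eq_of_le ?_ hle
  rw [prod_range_succ', prod_eq_one (s := range M), one_mul, prod_range_succ',
    ← prod_succ_add_two_div]
  · simp only [Nat.zero_lt_succ, if_true, lt_irrefl, if_false, mul_one]
    refine prod_congr rfl fun j _ => ?_
    push_cast
    ring
  · intro i _
    exact prod_eq_one fun j _ => by simp

lemma slDim_reflect (r : ℕ) (β : ℕ → ℚ) : slDim r (fun i => -β (r - 1 - i)) = slDim r β := by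
  unfold slDim
  rw [prod_comm, ← prod_range_reflect]
  refine prod_congr rfl fun i hi => ?_
  rw [← prod_range_reflect]
  refine prod_congr rfl fun j hj => ?_
  have hi := mem_range.1 hi
  have hj := mem_range.1 hj
  have h1 : r - 1 - (r - 1 - i) = i := by omega
  have h2 : r - 1 - (r - 1 - j) = j := by omega
  have h3 : ((r - 1 - i : ℕ) : ℚ) = r - 1 - i := by
    rw [Nat.cast_sub (by omega), Nat.cast_sub (by omega), Nat.cast_one]
  have h4 : ((r - 1 - j : ℕ) : ℚ) = r - 1 - j := by
    rw [Nat.cast_sub (by omega), Nat.cast_sub (by omega), Nat.cast_one]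
  dsimp only
  rw [h1, h2, h3, h4]
  by_cases h : i < j
  · rw [if_pos h, if_pos (by omega)]
    congr 1 <;> ring
  · rw [if_neg h, if_neg (by omega)]

lemma le_slDim_of_two_le_last_jump (M : ℕ) (β : ℕ → ℚ)
    (hβ : ∀ i j, i ≤ j → β j ≤ β i) (hjump : β M + 2 ≤ β (M - 1)) :
    ((M : ℚ) + 1) * (M + 2) / 2 ≤ slDim (M + 1) β := by
  rw [← slDim_reflect]
  refine le_slDim_of_two_le_first_jump M _ (fun i j hij => ?_) ?_
  · exact neg_le_neg (hβ _ _ (by omega))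
  · simp only [Nat.add_sub_cancel, Nat.sub_zero]
    linarith

/-- Jumps at both ends bound the Weyl dimension below by a product of a row and a column. -/
lemma sq_le_slDim_of_end_jumps (N : ℕ) (β : ℕ → ℚ)
    (hβ : ∀ i j, i ≤ j → β j ≤ β i) (hfst : β 1 + 1 ≤ β 0) (hlst : β (N + 1) + 1 ≤ β N) :
    ((N : ℚ) + 1) ^ 2 ≤ slDim (N + 2) β := by
  have hle := prod_le_slDim (N + 2) β
    (fun i j => if j = N + 1 then (if i = 0 then 1 else ((j : ℚ) - i + 1) / (j - i))
      else if i = 0 then ((j : ℚ) + 1) / j else 1)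
    (fun i j hij _ => by
      have : (i : ℚ) < j := by exact_mod_cast hij
      split_ifs
      · exact zero_le_one
      · exact div_nonneg (by linarith) (by linarith)
      · positivity
      · exact zero_le_one)
    (fun i j hij _ => by
      have : (i : ℚ) < j := by exact_mod_cast hij
      have hb := hβ i j hij.le
      split_ifs with h1 h2 h2
      · linarith
      · rw [div_mul_cancel₀ _ (by linarith), h1]
        linarith [hβ i N (by omega)]
      · subst h2
        rw [Nat.cast_zero] at this ⊢
        rw [sub_zero, div_mul_cancel₀ _ this.ne']
        linarith [hβ 1 j hij]
      · linarith)
  refine le_of_eq_of_le ?_ hle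
  have hrow : ∀ i ∈ range N, ∏ j ∈ range (N + 2), (if i + 1 < j then
      (if j = N + 1 then (if i + 1 = 0 then 1 else ((j : ℚ) - (i + 1 : ℕ) + 1) / (j - (i + 1 : ℕ)))
      else if i + 1 = 0 then ((j : ℚ) + 1) / j else 1) else 1) =
      ((N : ℚ) - i + 1) / (N - i) := by
    intro i hi
    have hi := mem_range.1 hi
    rw [prod_range_succ, prod_eq_one, one_mul, if_pos (by omega), if_pos rfl,
      if_neg (Nat.succ_ne_zero i)]
    · push_cast
      congr 1 <;> ring
    · intro j hj
      have hj := mem_range.1 hj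
      simp [show j ≠ N + 1 by omega]
  rw [prod_range_succ', prod_range_succ, prod_congr rfl hrow, prod_eq_one (s := range (N + 2)),
    mul_one, sq]
  · congr 1
    · rw [← prod_succ_add_one_div, ← prod_range_reflect]
      refine prod_congr rfl fun i hi => ?_
      have hi := mem_range.1 hi
      rw [Nat.cast_sub (by omega), Nat.cast_sub (by omega), Nat.cast_one]
      congr 1 <;> ring
    · rw [prod_range_succ, prod_range_succ', ← prod_succ_add_one_div]
      simp only [if_true, lt_irrefl, if_false, mul_one, Nat.zero_lt_succ]
      refine prod_congr rfl fun j hj => ?_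
      have hj := mem_range.1 hj
      rw [if_neg (by omega)]
      push_cast
      congr 1
      ring
  · intro j hj
    have hj := mem_range.1 hj
    rw [if_neg (by omega)]

lemma choose_two_le_choose (m p : ℕ) (h2 : 2 ≤ p) (hp : p + 2 ≤ m) :
    m.choose 2 ≤ m.choose p := by
  induction m generalizing p with
  | zero => omega
  | succ m ih =>
    rcases eq_or_lt_of_le h2 with rfl | h2
    · exact le_rfl
    rcases eq_or_lt_of_le hp with hp | hp
    · rw [← Nat.choose_symm (n := m + 1) (k := p) (by omega), show m + 1 - p = 2 by omega]
    obtain ⟨q, rfl⟩ : ∃ q, p = q + 1 := ⟨p - 1, by omega⟩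
    rw [Nat.choose_succ_succ m q, Nat.choose_succ_succ m 1, Nat.choose_one_right]
    have h3 := ih q (by omega) (by omega)
    have h4 := ih (q + 1) (by omega) (by omega)
    have h5 : m ≤ m.choose 2 := by
      rw [Nat.choose_two_right, Nat.le_div_iff_mul_le (by omega)]
      exact Nat.mul_le_mul_left m (by omega)
    simp only [Nat.succ_eq_add_one, Nat.reduceAdd] at *
    omega

lemma cast_choose_two_ge (m : ℕ) (hm : 6 ≤ m) : 3 * (m : ℚ) - 3 ≤ m.choose 2 := by
  rw [Nat.cast_choose_two]
  have : (6 : ℚ) ≤ m := by exact_mod_cast hm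
  nlinarith

/-- Classification of small irreducible representations of `sl(M + 1)`: besides the trivial one,
only the standard representation and its dual have dimension less than `3 * M`. -/
lemma eq_of_slDim_lt (M : ℕ) (hM : 5 ≤ M) (γ : ℕ → ℚ) (hint : ∀ i, ∃ z : ℤ, γ i = z)
    (hγ : ∀ i j, i ≤ j → γ j ≤ γ i) (hlast : γ M = 0) (hdim : slDim (M + 1) γ < 3 * M) :
    (∀ j, j ≤ M → γ j = 0) ∨ (γ 0 = 1 ∧ ∀ j, 1 ≤ j → j ≤ M → γ j = 0) ∨
      ∀ j, j < M → γ j = 1 := by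
  have hM' : (5 : ℚ) ≤ M := by exact_mod_cast hM
  have hconst : ∀ p, p + 2 ≤ M → γ (p + 1) = γ 1 := by
    intro p
    induction p with
    | zero => exact fun _ => rfl
    | succ p ih =>
      intro hp
      rw [← ih (by omega)]
      by_contra hne
      have hlt := lt_of_le_of_ne (hγ (p + 1) (p + 1 + 1) (by omega)) hne
      have hjump : γ (p + 2) + 1 ≤ γ (p + 2 - 1) := by
        obtain ⟨a, ha⟩ := hint (p + 1)
        obtain ⟨b, hb⟩ := hint (p + 2)
        simp only [show p + 2 - 1 = p + 1 by omega,
          show p + 1 + 1 = p + 2 by omega, ha, hb] at hlt ⊢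
        exact_mod_cast hlt
      have h1 := choose_le_slDim (M + 1) (p + 2) γ (by omega) (by omega) hγ hjump
      have h2 : ((M + 1).choose 2 : ℚ) ≤ (M + 1).choose (p + 2) := by
        exact_mod_cast choose_two_le_choose (M + 1) (p + 2) (by omega) (by omega)
      have h3 := cast_choose_two_ge (M + 1) (by omega)
      push_cast at h3
      linarith
  have hpen : γ (M - 1) = γ 1 := by
    have := hconst (M - 2) (by omega)
    rwa [show M - 2 + 1 = M - 1 by omega] at this
  obtain ⟨x, hx⟩ := hint 0
  obtain ⟨y, hy⟩ := hint 1
  have hxy : y ≤ x := by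
    have := hγ 0 1 (by omega)
    rw [hx, hy] at this
    exact_mod_cast this
  have hy0 : 0 ≤ y := by
    have := hγ 1 M (by omega)
    rw [hlast, hy] at this
    exact_mod_cast this
  have hx2 : x < y + 2 := by
    by_contra! h
    have := le_slDim_of_two_le_first_jump M γ hγ (by rw [hx, hy]; exact_mod_cast h)
    nlinarith
  have hy2 : y < 2 := by
    by_contra! h
    have := le_slDim_of_two_le_last_jump M γ hγ
      (by rw [hpen, hlast, hy, zero_add]; exact_mod_cast h)
    nlinarith
  have hboth : ¬ (y + 1 ≤ x ∧ 1 ≤ y) := by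
    rintro ⟨h1, h2⟩
    obtain ⟨N, rfl⟩ : ∃ N, M = N + 1 := ⟨M - 1, by omega⟩
    have := sq_le_slDim_of_end_jumps N γ hγ (by rw [hx, hy]; exact_mod_cast h1)
      (by rw [hlast, zero_add, ← Nat.add_sub_cancel (n := N) (m := 1), hpen, hy]
          exact_mod_cast h2)
    push_cast at *
    nlinarith
  have hmid : ∀ j, 1 ≤ j → j < M → γ j = y := by
    intro j h1 h2
    have := hconst (j - 1) (by omega)
    rwa [show j - 1 + 1 = j by omega, hy] at this
  have hcases : (y = 0 ∧ x = 0) ∨ (y = 0 ∧ x = 1) ∨ (y = 1 ∧ x = 1) := by omega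
  have hzero : y = 0 → ∀ j, 1 ≤ j → j ≤ M → γ j = 0 := by
    rintro rfl j h1 h2
    rcases eq_or_lt_of_le h2 with rfl | h2
    · exact hlast
    · simpa using hmid j h1 h2
  rcases hcases with ⟨h1, h2⟩ | ⟨h1, h2⟩ | ⟨h1, h2⟩
  · refine Or.inl fun j hj => ?_
    rcases Nat.eq_zero_or_pos j with rfl | hj0
    · rw [hx, h2, Int.cast_zero]
    · exact hzero h1 j hj0 hj
  · exact Or.inr (Or.inl ⟨by rw [hx, h2, Int.cast_one], hzero h1⟩)
  · refine Or.inr (Or.inr fun j hj => ?_)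
    rcases Nat.eq_zero_or_pos j with rfl | hj0
    · rw [hx, h2, Int.cast_one]
    · rw [hmid j hj0 hj, h1, Int.cast_one]

/-- A nonconstant weight of `sl(3)` has dimension at least three. -/
lemma eq_of_slDim_three_lt (β : ℕ → ℚ) (hint : ∀ i, ∃ z : ℤ, β i = z)
    (hβ : ∀ i j, i ≤ j → β j ≤ β i) (hdim : slDim 3 β < 3) : β 0 = β 1 ∧ β 1 = β 2 := by
  have key : ∀ p, p < 2 → β p = β (p + 1) := by
    intro p hp
    by_contra hne
    have hlt := lt_of_le_of_ne (hβ p (p + 1) (by omega)) (Ne.symm hne)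
    have hjump : β (p + 1) + 1 ≤ β (p + 1 - 1) := by
      obtain ⟨a, ha⟩ := hint p
      obtain ⟨b, hb⟩ := hint (p + 1)
      rw [ha, hb] at hlt
      rw [Nat.add_sub_cancel, ha, hb]
      exact_mod_cast hlt
    have := choose_le_slDim 3 (p + 1) β (by omega) (by omega) hβ hjump
    interval_cases p <;> norm_num at this <;> linarith
  exact ⟨key 0 (by omega), key 1 (by omega)⟩

/-- For `n ≥ 9`, a nonzero weight `β` for `Gr(3,n)` of rank at most `3(n−3) − 4`
has zero tail, or is `(r,r,r,1,0,…,0)`, or is `(s,s,s,1,…,1,0)`. -/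
theorem stmt8 (n : ℕ) (hn : 9 ≤ n) (β : ℕ → ℚ) (hβ : IsGrWeight n β) (hnz : β ≠ 0)
    (hr : grRank 3 n β ≤ 3 * ((n : ℚ) - 3) - 4) :
    (∀ j, 3 ≤ j → β j = 0) ∨
    (∃ r : ℤ, 1 ≤ r ∧ β 0 = (r : ℚ) ∧ β 1 = (r : ℚ) ∧ β 2 = (r : ℚ) ∧ β 3 = 1 ∧
      ∀ j, 4 ≤ j → β j = 0) ∨
    (∃ s : ℤ, 1 ≤ s ∧ β 0 = (s : ℚ) ∧ β 1 = (s : ℚ) ∧ β 2 = (s : ℚ) ∧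
      ∀ j, 3 ≤ j → j < n - 1 → β j = 1) := by
  obtain ⟨hint, hanti, hzero⟩ := hβ
  obtain ⟨M, rfl⟩ : ∃ M, n = M + 4 := ⟨n - 4, by omega⟩
  have hγint : ∀ i, ∃ z : ℤ, β (3 + i) = z := fun i => hint _
  have hγanti : ∀ i j, i ≤ j → β (3 + j) ≤ β (3 + i) := fun i j h => hanti _ _ (by omega)
  have hM : (5 : ℚ) ≤ M := by exact_mod_cast (by omega : 5 ≤ M)
  unfold grRank at hr
  rw [show M + 4 - 3 = M + 1 by omega] at hr
  push_cast at hr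
  have hhead := one_le_slDim_s8 3 β hanti
  have htail := one_le_slDim_s8 (M + 1) (fun i => β (3 + i)) hγanti
  have hclass := eq_of_slDim_lt M (by omega) (fun i => β (3 + i)) hγint hγanti
    (hzero _ (by omega)) (by nlinarith)
  by_cases htriv : ∀ j, j ≤ M → β (3 + j) = 0
  · refine Or.inl fun j hj => ?_
    by_cases h : j ≤ M + 3
    · simpa [show 3 + (j - 3) = j by omega] using htriv (j - 3) (by omega)
    · exact hzero j (by omega)
  have hbig : (M : ℚ) + 1 ≤ slDim (M + 1) (fun i => β (3 + i)) := by
    rcases hclass with h | ⟨h0, h⟩ | h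
    · exact absurd h htriv
    · have := choose_le_slDim (M + 1) 1 (fun i => β (3 + i)) (by omega) (by omega) hγanti
        (by have := h 1 le_rfl (by omega)
            rw [Nat.sub_self]
            linarith)
      simpa using this
    · have := choose_le_slDim (M + 1) M (fun i => β (3 + i)) (by omega) (by omega) hγanti
        (by have h1 := h (M - 1) (by omega)
            have h2 := hzero (3 + M) (by omega)
            linarith)
      simpa using this
  obtain ⟨h01, h12⟩ := eq_of_slDim_three_lt β hint hanti (by
    by_contra! h
    nlinarith)
  obtain ⟨r, hr2⟩ := hint 2
  have hr1 : β 3 = 1 → 1 ≤ r := by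
    intro h
    have := hanti 2 3 (by omega)
    rw [h, hr2] at this
    exact_mod_cast this
  rcases hclass with h | ⟨h0, h⟩ | h
  · exact absurd h htriv
  · refine Or.inr (Or.inl ⟨r, hr1 h0, by rw [h01, h12, hr2], by rw [h12, hr2], hr2, h0, ?_⟩)
    intro j hj
    by_cases hjM : j ≤ M + 3
    · simpa [show 3 + (j - 3) = j by omega] using h (j - 3) (by omega) (by omega)
    · exact hzero j (by omega)
  · refine Or.inr (Or.inr ⟨r, hr1 (h 0 (by omega)), by rw [h01, h12, hr2], by rw [h12, hr2],
      hr2, ?_⟩)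
    intro j hj hjM
    simpa [show 3 + (j - 3) = j by omega] using h (j - 3) (by omega)
end
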